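/- arXiv:1407.7872 — 2 statements merged into one kernel-verified Lean document; each statement's English description precedes it below -/
import Mathlib

section
/- Let K be a compact Hausdorff space and let X be a uniformly convex real Banach space. Then the pair (C(K), X) has the Bishop–Phelps–Bollobás property for operators: for every ε with 0 < ε < 1 there exists η > 0 such that whenever T : C(K) → X is a bounded linear operator with ‖T‖ = 1 and f₀ ∈ C(K) with ‖f₀‖ = 1 satisfy ‖T f₀‖ > 1 − η, there exist a bounded linear operator S : C(K) → X with ‖S‖ = 1 and g ∈ C(K) with ‖g‖ = 1 such that ‖S g‖ = 1, ‖f₀ − g‖ < ε and ‖T − S‖ < ε. -/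
open Filter Topology

/-- In a uniformly convex space, a vector `u` of norm close to `1` only admits small `v` with
both `u + v` and `u - v` in the unit ball. -/
theorem UniformConvexSpace.exists_forall_norm_lt (X : Type*) [NormedAddCommGroup X]
    [NormedSpace ℝ X] [UniformConvexSpace X] {ε : ℝ} (hε : 0 < ε) :
    ∃ δ > 0, ∀ u v : X, ‖u + v‖ ≤ 1 → ‖u - v‖ ≤ 1 → 1 - δ < ‖u‖ → ‖v‖ < ε := by
  obtain ⟨δ, hδ, h⟩ := exists_forall_closed_ball_dist_add_le_two_sub X (ε := 2 * ε) (by linarith)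
  refine ⟨δ / 2, by linarith, fun u v h₁ h₂ hu => ?_⟩
  by_contra! hv
  have hd : u + v - (u - v) = (2 : ℝ) • v := by module
  have hs : u + v + (u - v) = (2 : ℝ) • u := by module
  have := h h₁ h₂ (by rw [hd, norm_smul]; norm_num; linarith)
  rw [hs, norm_smul] at this
  norm_num at this
  linarith

section

variable {K : Type*} [TopologicalSpace K] [CompactSpace K]
  {X : Type*} [NormedAddCommGroup X] [NormedSpace ℝ X]

/-- The operator `h ↦ T (f * h)`. -/
noncomputable def ContinuousLinearMap.compMul (T : C(K, ℝ) →L[ℝ] X) (f : C(K, ℝ)) :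
    C(K, ℝ) →L[ℝ] X :=
  T.comp (ContinuousLinearMap.mul ℝ C(K, ℝ) f)

@[simp]
theorem ContinuousLinearMap.compMul_apply (T : C(K, ℝ) →L[ℝ] X) (f h : C(K, ℝ)) :
    T.compMul f h = T (f * h) := rfl

theorem ContinuousLinearMap.norm_compMul_le (T : C(K, ℝ) →L[ℝ] X) {f : C(K, ℝ)}
    (hf : ‖f‖ ≤ 1) : ‖T.compMul f‖ ≤ ‖T‖ := by
  refine (T.opNorm_comp_le _).trans ?_
  have := (ContinuousLinearMap.opNorm_mul_apply_le ℝ C(K, ℝ) f).trans hf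
  exact mul_le_of_le_one_right (norm_nonneg _) this

/-- If `T` almost attains its norm at `f` and `|f| + |q| ≤ 1`, then `h ↦ T (q * h)` is small. -/
theorem UniformConvexSpace.exists_forall_norm_compMul_le (X : Type*) [NormedAddCommGroup X]
    [NormedSpace ℝ X] [UniformConvexSpace X] {ε : ℝ} (hε : 0 < ε) :
    ∃ δ > 0, ∀ (T : C(K, ℝ) →L[ℝ] X) (f q : C(K, ℝ)), ‖T‖ ≤ 1 → (∀ k, |f k| + |q k| ≤ 1) →
      1 - δ < ‖T f‖ → ‖T.compMul q‖ ≤ ε := by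
  obtain ⟨δ, hδ, H⟩ := UniformConvexSpace.exists_forall_norm_lt X hε
  refine ⟨δ, hδ, fun T f q hT hfq hf => ?_⟩
  refine ContinuousLinearMap.opNorm_le_of_unit_norm hε.le fun h hh => ?_
  have hqh (k : K) : |q k * h k| ≤ |q k| := by
    rw [abs_mul]
    exact mul_le_of_le_one_right (abs_nonneg _) (hh ▸ h.norm_coe_le_norm k)
  refine (H (T f) (T (q * h)) ?_ ?_ hf).le
  · rw [← map_add]
    refine T.le_of_opNorm_le_of_le hT ?_ |>.trans (one_mul (1 : ℝ)).le
    refine (ContinuousMap.norm_le _ zero_le_one).2 fun k => ?_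
    exact (abs_add_le _ _).trans ((add_le_add_right (hqh k) _).trans (hfq k))
  · rw [← map_sub]
    refine T.le_of_opNorm_le_of_le hT ?_ |>.trans (one_mul (1 : ℝ)).le
    refine (ContinuousMap.norm_le _ zero_le_one).2 fun k => ?_
    exact (abs_sub _ _).trans ((add_le_add_right (hqh k) _).trans (hfq k))

/-- An operator almost attaining its norm at `1` can be perturbed so as to attain its norm at `1`
up to an arbitrarily small error. -/
theorem exists_norm_one_apply_ge_of_norm_one_apply_ge [UniformConvexSpace X] {ε : ℝ}
    (hε : 0 < ε) :
    ∃ η > 0, ∀ T : C(K, ℝ) →L[ℝ] X, ‖T‖ ≤ 1 → 1 - η ≤ ‖T 1‖ → ∀ τ > 0,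
      ∃ N : C(K, ℝ) →L[ℝ] X, ‖N‖ ≤ 1 ∧ 1 - τ ≤ ‖N 1‖ ∧ ‖T - N‖ ≤ ε ∧
        ∀ e, T.compMul e = T → N.compMul e = N := by
  obtain ⟨δ₀, hδ₀, H⟩ :=
    UniformConvexSpace.exists_forall_norm_compMul_le (K := K) X (ε := ε / 8) (by linarith)
  obtain ⟨δ, hδ, hδ2, hδε, hδδ₀⟩ : ∃ δ : ℝ, 0 < δ ∧ δ ≤ 1 / 2 ∧ δ ≤ ε / 8 ∧ δ ≤ δ₀ / 2 :=
    ⟨min (1 / 2) (min (ε / 8) (δ₀ / 2)), by positivity, by simp, by simp, by simp⟩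
  refine ⟨δ ^ 2 / 8, by positivity, fun T hT hT1 τ hτ => ?_⟩
  set η := δ ^ 2 / 8 with hη
  have hηδ : η ≤ δ / 16 := by nlinarith
  have hη0 : 0 < η := by positivity
  have norm_one_le : ‖(1 : C(K, ℝ))‖ ≤ 1 :=
    (ContinuousMap.norm_le _ zero_le_one).2 fun k => by simp
  have hT1' : ‖T 1‖ ≤ 1 := (T.le_of_opNorm_le_of_le hT norm_one_le).trans (one_mul (1 : ℝ)).le
  obtain ⟨ψ, hψ, hψ1⟩ := exists_dual_vector'' ℝ (T 1)
  simp only [RCLike.ofReal_real_eq_id, id] at hψ1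
  set a := ‖T 1‖ with ha
  set D : C(K, ℝ) →L[ℝ] X := δ • (ψ.comp T).smulRight (T 1) with hD
  have D_apply (h) : D h = (δ * ψ (T h)) • T 1 := by simp [hD, smul_smul]
  have ψ_le {h : C(K, ℝ)} (hh : ‖h‖ ≤ 1) : |ψ (T h)| ≤ 1 := by
    have h₁ := T.le_of_opNorm_le_of_le hT hh
    have h₂ := ψ.le_of_opNorm_le_of_le hψ h₁
    simpa using h₂
  have norm_D : ‖D‖ ≤ δ := by
    refine ContinuousLinearMap.opNorm_le_of_unit_norm hδ.le fun h hh => ?_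
    rw [D_apply, norm_smul, Real.norm_eq_abs, abs_mul, abs_of_pos hδ, ← ha]
    have := ψ_le hh.le
    have : |ψ (T h)| * a ≤ 1 := mul_le_one₀ this (norm_nonneg _) hT1'
    nlinarith
  set c := ‖T + D‖ with hc
  have hcle : c ≤ 1 + δ := (norm_add_le T D).trans (add_le_add hT norm_D)
  have hcge : a + δ * a ^ 2 ≤ c := by
    have h₁ : ‖(T + D) 1‖ ≤ c := by
      simpa using (T + D).le_of_opNorm_le_of_le le_rfl norm_one_le
    have h₂ : (T + D) 1 = (1 + δ * a) • T 1 := by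
      rw [add_apply, D_apply, hψ1]; module
    rw [h₂, norm_smul, Real.norm_of_nonneg (by positivity), ← ha] at h₁
    linarith
  have hca : 1 - η ≤ c := by nlinarith [sq_nonneg a]
  have hc0 : 0 < c := by linarith
  obtain ⟨σ, hσ, hση, hστ⟩ : ∃ σ : ℝ, 0 < σ ∧ σ ≤ η ∧ σ ≤ τ / 2 :=
    ⟨min η (τ / 2), by positivity, by simp, by simp⟩
  obtain ⟨f, hf, hfσ, hfψ⟩ : ∃ f : C(K, ℝ), ‖f‖ ≤ 1 ∧ c - σ < ‖(T + D) f‖ ∧ 0 ≤ ψ (T f) := by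
    obtain ⟨f, hf, hfσ⟩ := (T + D).exists_lt_apply_of_lt_opNorm (show c - σ < c by linarith)
    rcases le_total 0 (ψ (T f)) with h | h
    · exact ⟨f, hf.le, hfσ, h⟩
    · exact ⟨-f, by simpa using hf.le, by rwa [map_neg, norm_neg], by simpa using h⟩
  have hTDf : ‖(T + D) f‖ ≤ 1 + δ * ψ (T f) := by
    have h₁ : ‖T f‖ ≤ 1 := by simpa using T.le_of_opNorm_le_of_le hT hf
    refine (norm_add_le (T f) (D f)).trans (add_le_add h₁ ?_)
    rw [D_apply, norm_smul, Real.norm_of_nonneg (by positivity)]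
    exact mul_le_of_le_one_right (by positivity) hT1'
  have hψf : 1 - δ ≤ ψ (T f) := by
    by_contra! hlt
    have h₁ : (1 - η) ^ 2 ≤ a ^ 2 := pow_le_pow_left₀ (by linarith) hT1 2
    have h₂ : δ * (1 - η) ^ 2 ≤ δ * a ^ 2 := by gcongr
    have h₃ : δ * ψ (T f) < δ * (1 - δ) := by gcongr
    have h₄ : δ * η ≤ η / 2 := by nlinarith
    have h₅ : 0 ≤ δ * η ^ 2 := by positivity
    linarith
  have hsmall : ‖T.compMul (1 - f)‖ ≤ ε / 4 := by
    have hFn : 1 - δ₀ < ‖T ((1 / 2 : ℝ) • (1 + f))‖ := by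
      have h₁ := ψ.le_of_opNorm_le hψ (T ((1 / 2 : ℝ) • (1 + f)))
      rw [one_mul] at h₁
      refine lt_of_lt_of_le ?_ ((le_abs_self _).trans h₁)
      simp only [map_smul, map_add, hψ1, smul_eq_mul]
      linarith
    have h₂ := H T ((1 / 2 : ℝ) • (1 + f)) ((1 / 2 : ℝ) • (1 - f)) hT (fun k => ?_) hFn
    · have h₃ : T.compMul (1 - f) = (2 : ℝ) • T.compMul ((1 / 2 : ℝ) • (1 - f)) := by
        ext h
        simp
      rw [h₃]
      refine (ContinuousLinearMap.opNorm_smul_le _ _).trans ?_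
      rw [Real.norm_of_nonneg (by norm_num)]
      linarith
    · have h₃ := abs_le.1 ((f.norm_coe_le_norm k).trans hf)
      simp only [ContinuousMap.coe_smul, ContinuousMap.coe_add, ContinuousMap.coe_sub,
        Pi.smul_apply, Pi.add_apply, Pi.sub_apply, ContinuousMap.one_apply, smul_eq_mul]
      rw [abs_of_nonneg (by linarith), abs_of_nonneg (by linarith)]
      linarith
  refine ⟨c⁻¹ • (T + D).compMul f, ?_, ?_, ?_, fun e he => ?_⟩
  · refine (ContinuousLinearMap.opNorm_smul_le _ _).trans ?_
    rw [Real.norm_of_nonneg (by positivity), inv_mul_le_one₀ hc0]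
    exact (T + D).norm_compMul_le hf
  · rw [smul_apply, norm_smul, Real.norm_of_nonneg (by positivity),
      ContinuousLinearMap.compMul_apply, mul_one, ← div_eq_inv_mul, le_div_iff₀ hc0]
    nlinarith
  · have h₁ : T - c⁻¹ • (T + D).compMul f =
        T.compMul (1 - f) - D.compMul f - (c⁻¹ * (1 - c)) • (T + D).compMul f := by
      ext h
      simp only [sub_apply, smul_apply,
        ContinuousLinearMap.compMul_apply, add_apply, sub_mul, one_mul,
        map_sub, mul_sub, mul_one, inv_mul_cancel₀ hc0.ne']
      module
    have h₂ : ‖(c⁻¹ * (1 - c)) • (T + D).compMul f‖ ≤ δ := by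
      have h₃ : |1 - c| ≤ δ := abs_le.2 ⟨by linarith, by linarith⟩
      refine (ContinuousLinearMap.opNorm_smul_le _ _).trans ?_
      rw [norm_mul, Real.norm_of_nonneg (by positivity : 0 ≤ c⁻¹), Real.norm_eq_abs]
      calc c⁻¹ * |1 - c| * ‖(T + D).compMul f‖ ≤ c⁻¹ * δ * c := by
            gcongr; exact (T + D).norm_compMul_le hf
        _ = δ := by field_simp
    rw [h₁]
    refine (norm_sub_le (T.compMul (1 - f) - D.compMul f) _).trans ?_
    have h₃ := norm_sub_le (T.compMul (1 - f)) (D.compMul f)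
    linarith [(D.norm_compMul_le hf).trans norm_D]
  · have he' (h) : T (e * h) = T h := DFunLike.congr_fun he h
    ext h
    simp only [smul_apply, ContinuousLinearMap.compMul_apply,
      add_apply, D_apply, mul_left_comm f e h, he']

/-- An operator almost attaining its norm at `1` is close to one attaining its norm at `1`. -/
theorem exists_norm_one_apply_eq_of_norm_one_apply_ge [CompleteSpace X] [UniformConvexSpace X]
    {ε : ℝ} (hε : 0 < ε) :
    ∃ η > 0, ∀ T : C(K, ℝ) →L[ℝ] X, ‖T‖ ≤ 1 → 1 - η ≤ ‖T 1‖ →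
      ∃ R : C(K, ℝ) →L[ℝ] X, ‖R‖ ≤ 1 ∧ ‖R 1‖ = 1 ∧ ‖T - R‖ ≤ ε ∧
        ∀ e, T.compMul e = T → R.compMul e = R := by
  have hpos (n : ℕ) : 0 < ε / 2 / 2 ^ n := by positivity
  choose η hη0 hη using fun n =>
    exists_norm_one_apply_ge_of_norm_one_apply_ge (K := K) (X := X) (hpos n)
  refine ⟨η 0, hη0 0, fun T hT hT1 => ?_⟩
  let A (n : ℕ) := {N : C(K, ℝ) →L[ℝ] X // ‖N‖ ≤ 1 ∧ 1 - η n ≤ ‖N 1‖}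
  have hstep (n : ℕ) (N : A n) : ∃ M : A (n + 1), 1 - 1 / ((n : ℝ) + 1) ≤ ‖M.1 1‖ ∧
      ‖N.1 - M.1‖ ≤ ε / 2 / 2 ^ n ∧ ∀ e, N.1.compMul e = N.1 → M.1.compMul e = M.1 := by
    obtain ⟨M, hM, hM1, hNM, he⟩ := hη n N.1 N.2.1 N.2.2
      (min (η (n + 1)) (1 / ((n : ℝ) + 1))) (lt_min (hη0 _) (by positivity))
    refine ⟨⟨M, hM, le_trans ?_ hM1⟩, le_trans ?_ hM1, hNM, he⟩
    · exact sub_le_sub_left (min_le_left _ _) _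
    · exact sub_le_sub_left (min_le_right _ _) _
  choose next hnext1 hnext hnexte using hstep
  let N (n : ℕ) : A n := Nat.rec ⟨T, hT, hT1⟩ next n
  have hdist (n : ℕ) : dist (N n).1 (N (n + 1)).1 ≤ ε / 2 / 2 ^ n := by
    exact (dist_eq_norm (N n).1 (N (n + 1)).1).trans_le (hnext n (N n))
  obtain ⟨R, hR⟩ := cauchySeq_tendsto_of_complete (cauchySeq_of_le_geometric_two hdist)
  have happly (h) : Tendsto (fun n => (N n).1 h) atTop (𝓝 (R h)) :=
    ((ContinuousLinearMap.apply ℝ X h).continuous.tendsto R).comp hR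
  have hRle : ‖R‖ ≤ 1 := by
    refine R.opNorm_le_bound zero_le_one fun h => ?_
    exact le_of_tendsto' (happly h).norm fun n => (N n).1.le_of_opNorm_le (N n).2.1 h
  refine ⟨R, hRle, le_antisymm ?_ ?_, ?_, fun e he => ?_⟩
  · refine (R.le_of_opNorm_le_of_le hRle ?_).trans (one_mul (1 : ℝ)).le
    exact (ContinuousMap.norm_le _ zero_le_one).2 fun k => by simp
  · have h₁ : Tendsto (fun n : ℕ => 1 - 1 / ((n : ℝ) + 1)) atTop (𝓝 (1 - 0)) :=
      tendsto_const_nhds.sub tendsto_one_div_add_atTop_nhds_zero_nat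
    rw [sub_zero] at h₁
    exact le_of_tendsto_of_tendsto' h₁ ((happly 1).norm.comp (tendsto_add_atTop_nat 1))
      fun n => hnext1 n (N n)
  · exact (dist_eq_norm T R).symm.trans_le (dist_le_of_le_geometric_two_of_tendsto₀ hdist hR)
  · have hN (n : ℕ) : (N n).1.compMul e = (N n).1 := by
      induction n with
      | zero => exact he
      | succ n ih => exact hnexte n (N n) e ih
    ext h
    refine tendsto_nhds_unique (happly (e * h)) ((happly h).congr fun n => ?_)
    exact DFunLike.congr_fun (hN n).symm h

/-- Every `f` in the unit ball of `C(K)` is `β`-close to some `g` in the unit ball which is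
unimodular on the support of a cut-off `w` that equals `1` wherever `|f|` is close to `1`. -/
theorem ContinuousMap.exists_unimodular_cutoff {f : C(K, ℝ)} (hf : ‖f‖ ≤ 1) {β : ℝ}
    (hβ : 0 < β) (hβ1 : β < 1) :
    ∃ g w : C(K, ℝ), ‖g‖ ≤ 1 ∧ ‖f - g‖ ≤ β ∧ ‖w‖ ≤ 1 ∧ w * (g * g) = w ∧
      ∀ k, |f k| + |((β / 2) • (1 - w)) k| ≤ 1 := by
  have hfk (k : K) : |f k| ≤ 1 := (f.norm_coe_le_norm k).trans hf
  have hβ' : 0 < 1 - β := by linarith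
  let g : C(K, ℝ) := ⟨fun k => max (-1) (min 1 (f k / (1 - β))), by fun_prop⟩
  let w : C(K, ℝ) := ⟨fun k => max 0 (min 1 ((|f k| - (1 - β)) / (β / 2))),
    by fun_prop (disch := positivity)⟩
  have hw0 (k : K) : 0 ≤ w k := le_max_left _ _
  have hw1 (k : K) : w k ≤ 1 := max_le zero_le_one (min_le_left _ _)
  refine ⟨g, w, ?_, ?_, ?_, ?_, fun k => ?_⟩
  · refine (ContinuousMap.norm_le _ zero_le_one).2 fun k => abs_le.2
      ⟨le_max_left _ (min 1 (f k / (1 - β))), ?_⟩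
    exact max_le (by norm_num : (-1 : ℝ) ≤ 1) (min_le_left _ _)
  · refine (ContinuousMap.norm_le _ hβ.le).2 fun k => ?_
    have h₁ := abs_le.1 (hfk k)
    have h₂ : f k / (1 - β) * (1 - β) = f k := div_mul_cancel₀ _ hβ'.ne'
    change |f k - max (-1) (min 1 (f k / (1 - β)))| ≤ β
    generalize f k / (1 - β) = t at *
    rw [abs_le]
    rcases max_cases (-1) (min 1 t) with ⟨h, h'⟩ | ⟨h, h'⟩ <;>
      rcases min_cases 1 t with ⟨h₃, h₄⟩ | ⟨h₃, h₄⟩ <;> rw [h] <;> constructor <;> nlinarith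
  · refine (ContinuousMap.norm_le _ zero_le_one).2 fun k => abs_le.2 ⟨?_, hw1 k⟩
    linarith [hw0 k]
  · ext k
    change w k * (g k * g k) = w k
    rcases le_or_gt |f k| (1 - β) with h | h
    · have : w k = 0 := by
        refine max_eq_left ((min_le_right _ _).trans ?_)
        exact div_nonpos_of_nonpos_of_nonneg (by linarith) (by linarith)
      simp [this]
    · have : g k = 1 ∨ g k = -1 := by
        rcases lt_abs.1 h with h | h
        · left
          have : 1 ≤ f k / (1 - β) := by rw [le_div_iff₀ hβ']; linarith
          simp [g, this]
        · right
          have : f k / (1 - β) ≤ -1 := by rw [div_le_iff₀ hβ']; linarith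
          simp [g, this]
      rcases this with h | h <;> simp [h]
  · simp only [ContinuousMap.coe_smul, ContinuousMap.coe_sub, Pi.smul_apply, Pi.sub_apply,
      ContinuousMap.one_apply, smul_eq_mul]
    rw [abs_of_nonneg (a := β / 2 * (1 - w k)) (mul_nonneg (by linarith) (by linarith [hw1 k]))]
    rcases le_or_gt (1 - β / 2) |f k| with h | h
    · have : w k = 1 := by
        have : 1 ≤ (|f k| - (1 - β)) / (β / 2) := by rw [le_div_iff₀ (by linarith)]; linarith
        simp [w, this]
      simp [this, hfk k]
    · nlinarith [hw0 k]

end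


/-- **Bishop–Phelps–Bollobás property for `(C(K), X)`** where `K` is a compact Hausdorff
space and `X` is a uniformly convex real Banach space: for every `0 < ε < 1` there is
`η > 0` such that whenever `T : C(K) → X` with `‖T‖ = 1` and `f₀` with `‖f₀‖ = 1` satisfy
`‖T f₀‖ > 1 - η`, there are `S` with `‖S‖ = 1` and `g` with `‖g‖ = 1` such that
`‖S g‖ = 1`, `‖f₀ - g‖ < ε` and `‖T - S‖ < ε`. -/
theorem bpbp_continuousMap_uniformConvex
    {K : Type*} [TopologicalSpace K] [CompactSpace K] [T2Space K]
    {X : Type*} [NormedAddCommGroup X] [NormedSpace ℝ X] [CompleteSpace X]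
    [UniformConvexSpace X]
    {ε : ℝ} (hε0 : 0 < ε) (hε1 : ε < 1) :
    ∃ η > (0 : ℝ), ∀ (T : C(K, ℝ) →L[ℝ] X) (f₀ : C(K, ℝ)),
      ‖T‖ = 1 → ‖f₀‖ = 1 → ‖T f₀‖ > 1 - η →
      ∃ (S : C(K, ℝ) →L[ℝ] X) (g : C(K, ℝ)),
        ‖S‖ = 1 ∧ ‖g‖ = 1 ∧ ‖S g‖ = 1 ∧ ‖f₀ - g‖ < ε ∧ ‖T - S‖ < ε := by
  obtain ⟨η₁, hη₁, H₁⟩ :=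
    exists_norm_one_apply_eq_of_norm_one_apply_ge (K := K) (X := X) (ε := ε / 2) (by linarith)
  obtain ⟨β, hβ, hβε, hβη⟩ : ∃ β : ℝ, 0 < β ∧ β ≤ ε / 2 ∧ β ≤ η₁ / 4 :=
    ⟨min (ε / 2) (η₁ / 4), by positivity, by simp, by simp⟩
  obtain ⟨η, hη, H⟩ := UniformConvexSpace.exists_forall_norm_compMul_le (K := K) X
    (ε := β / 2 * β / 2) (by positivity)
  refine ⟨min η (η₁ / 4), by positivity, fun T f hT hf hTf => ?_⟩
  have hTη : 1 - η < ‖T f‖ := by linarith [min_le_left η (η₁ / 4)]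
  have hTη₁ : 1 - η₁ / 4 < ‖T f‖ := by linarith [min_le_right η (η₁ / 4)]
  obtain ⟨g, w, hg, hfg, hw, hwg, hfw⟩ :=
    ContinuousMap.exists_unimodular_cutoff hf.le hβ (by linarith)
  have hsmall : ‖T.compMul (1 - w)‖ ≤ β / 2 := by
    have h₁ := H T f _ hT.le hfw hTη
    have h₂ : T.compMul (1 - w) = (β / 2)⁻¹ • T.compMul ((β / 2) • (1 - w)) := by
      ext h
      simp [smul_smul, hβ.ne']
    rw [h₂]
    refine (ContinuousLinearMap.opNorm_smul_le _ _).trans ?_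
    rw [Real.norm_of_nonneg (by positivity), inv_mul_le_iff₀ (by positivity)]
    linarith
  set Q := T.compMul (w * g) with hQ
  have hwgn : ‖w * g‖ ≤ 1 := (norm_mul_le _ _).trans (mul_le_one₀ hw (norm_nonneg _) hg)
  have hQ1 : 1 - η₁ ≤ ‖Q 1‖ := by
    have h₁ : T f = Q 1 + T (f - g) + T.compMul (1 - w) g := by
      simp only [hQ, ContinuousLinearMap.compMul_apply, ← map_add]
      congr 1
      ring
    have h₂ : ‖T (f - g)‖ ≤ 1 * β := T.le_of_opNorm_le_of_le hT.le hfg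
    have h₃ : ‖T.compMul (1 - w) g‖ ≤ β / 2 * 1 :=
      (T.compMul (1 - w)).le_of_opNorm_le_of_le hsmall hg
    have h₄ := norm_add₃_le (a := Q 1) (b := T (f - g)) (c := T.compMul (1 - w) g)
    rw [← h₁] at h₄
    linarith
  obtain ⟨R, hR, hR1, hQR, hRe⟩ := H₁ Q ((T.norm_compMul_le hwgn).trans hT.le) hQ1
  have hRg : R.compMul (g * g) = R := by
    refine hRe _ ?_
    ext h
    simp only [hQ, ContinuousLinearMap.compMul_apply]
    congr 1
    linear_combination (g * h) * hwg
  have hSg : ‖R.compMul g g‖ = 1 := by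
    rw [← hR1, ← DFunLike.congr_fun hRg 1, ContinuousLinearMap.compMul_apply,
      ContinuousLinearMap.compMul_apply, mul_one]
  have hS : ‖R.compMul g‖ ≤ 1 := (R.norm_compMul_le hg).trans hR
  have hSgle := (R.compMul g).le_opNorm g
  rw [hSg] at hSgle
  refine ⟨R.compMul g, g, le_antisymm hS ?_, le_antisymm hg ?_, hSg, by linarith, ?_⟩
  · exact hSgle.trans (mul_le_of_le_one_right (norm_nonneg _) hg)
  · exact hSgle.trans (mul_le_of_le_one_left (norm_nonneg _) hS)
  · have h₁ : T - R.compMul g = T.compMul (1 - w) + (Q - R).compMul g := by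
      ext h
      simp only [hQ, ContinuousLinearMap.compMul_apply, sub_apply, add_apply, ← add_sub_assoc, ← map_add]
      congr 2
      linear_combination (-h) * hwg
    rw [h₁]
    refine (norm_add_le (T.compMul (1 - w)) ((Q - R).compMul g)).trans_lt ?_
    linarith [(Q - R).norm_compMul_le hg]
end

section
/- Let 0 < ε < 1, let X be a reflexive real Banach space, and let Y be a uniformly convex real Banach space with modulus of convexity δ_Y. If T ∈ L(X,Y) with ‖T‖ = 1 and x₁ ∈ X with ‖x₁‖ = 1 satisfy ‖T x₁‖ > 1 − (ε/2⁵)·δ_Y(ε/2), then there exist S ∈ L(X,Y) with ‖S‖ = 1 and x₂ ∈ X with ‖x₂‖ = 1 such that ‖S x₂‖ = 1, ‖S − T‖ < ε and ‖T x₁ − S x₂‖ < ε. -/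
/-- The modulus of convexity of a real normed space `Y`:
`δ_Y(ε) = inf {1 - ‖(x+y)/2‖ : ‖x‖ ≤ 1, ‖y‖ ≤ 1, ‖x - y‖ ≥ ε}`. -/
noncomputable def modulusOfConvexity (Y : Type*) [NormedAddCommGroup Y] (ε : ℝ) : ℝ :=
  sInf {d : ℝ | ∃ x y : Y, ‖x‖ ≤ 1 ∧ ‖y‖ ≤ 1 ∧ ε ≤ ‖x - y‖ ∧ d = 1 - ‖x + y‖ / 2}

open Filter Topology Metric

/-- In a reflexive space, every family in the closed unit ball has a weak limit in the ball along
any ultrafilter. -/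
lemma exists_weak_limit_of_reflexive {X ι : Type*} [NormedAddCommGroup X] [NormedSpace ℝ X]
    (hrefl : Function.Surjective ⇑(NormedSpace.inclusionInDoubleDual ℝ X))
    (F : Ultrafilter ι) (x : ι → X) (hx : ∀ i, ‖x i‖ ≤ 1) :
    ∃ z : X, ‖z‖ ≤ 1 ∧ ∀ f : StrongDual ℝ X, Tendsto (fun i => f (x i)) F (𝓝 (f z)) := by
  let J : X → WeakDual ℝ (StrongDual ℝ X) := fun z =>
    StrongDual.toWeakDual (NormedSpace.inclusionInDoubleDual ℝ X z)
  have hnorm : ∀ z : X, ‖NormedSpace.inclusionInDoubleDual ℝ X z‖ = ‖z‖ :=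
    fun z => (NormedSpace.inclusionInDoubleDualLi ℝ (E := X)).norm_map z
  obtain ⟨ψ, hψ, hlim⟩ := (WeakDual.isCompact_closedBall
    (0 : StrongDual ℝ (StrongDual ℝ X)) 1).ultrafilter_le_nhds (F.map fun i => J (x i)) (by
      rw [Ultrafilter.coe_map, le_principal_iff, mem_map]
      filter_upwards with i
      simpa [J, hnorm] using hx i)
  obtain ⟨z, hz⟩ := hrefl (WeakDual.toStrongDual ψ)
  refine ⟨z, ?_, fun f => ?_⟩
  · rw [← hnorm, hz]
    simpa using hψ
  · have hz' : f z = ψ f := by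
      rw [← NormedSpace.dual_def ℝ X z f, hz]; rfl
    rw [hz']
    exact ((WeakDual.eval_continuous f).tendsto ψ).comp hlim

/-- The Lindenstrauss rank-one perturbation of `T` in the direction of `T x₀`. -/
lemma exists_rankOne_perturbation {X Y : Type*} [NormedAddCommGroup X] [NormedSpace ℝ X]
    [NormedAddCommGroup Y] [NormedSpace ℝ Y] (T : X →L[ℝ] Y) {x₀ : X} (hx₀ : ‖x₀‖ ≤ 1)
    {a : ℝ} (ha : 0 ≤ a) :
    ∃ (g : StrongDual ℝ Y) (T' : X →L[ℝ] Y), ‖g‖ ≤ 1 ∧ g (T x₀) = ‖T x₀‖ ∧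
      (1 + a) * ‖T x₀‖ ≤ ‖T'‖ ∧ ‖T' - T‖ ≤ a * ‖T‖ ∧
      ∀ x, ‖T' x‖ ≤ ‖T x‖ + a * |g (T x)| := by
  obtain ⟨g, hg, hgx⟩ := exists_dual_vector'' ℝ (T x₀)
  simp only [RCLike.ofReal_real_eq_id, id_eq] at hgx
  obtain ⟨u, hu, hux⟩ : ∃ u : Y, ‖u‖ ≤ 1 ∧ ‖T x₀‖ • u = T x₀ := by
    rcases eq_or_ne (T x₀) 0 with h | h
    · exact ⟨0, by simp, by simp [h]⟩
    · exact ⟨‖T x₀‖⁻¹ • T x₀, (norm_smul_inv_norm (𝕜 := ℝ) h).le,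
        smul_inv_smul₀ (norm_ne_zero_iff.2 h) _⟩
  have hgT : ∀ x, |g (T x)| ≤ ‖T x‖ := fun x => by
    simpa using g.le_of_opNorm_le hg (T x)
  let R : X →L[ℝ] Y := a • (g.comp T).smulRight u
  have hR : ∀ x, ‖R x‖ ≤ a * |g (T x)| := fun x => by
    have : ‖R x‖ = a * (|g (T x)| * ‖u‖) := by
      simp [R, norm_smul, abs_of_nonneg ha]
    rw [this]
    exact mul_le_mul_of_nonneg_left (mul_le_of_le_one_right (abs_nonneg _) hu) ha
  refine ⟨g, T + R, hg, hgx, ?_, ?_, fun x => ?_⟩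
  · have h : (T + R) x₀ = (1 + a) • T x₀ := by
      simp [R, hgx, hux, add_smul]
    calc (1 + a) * ‖T x₀‖ = ‖(T + R) x₀‖ := by
          rw [h, norm_smul, Real.norm_of_nonneg (by positivity)]
      _ ≤ ‖T + R‖ := (T + R).unit_le_opNorm x₀ hx₀
  · rw [add_sub_cancel_left]
    refine R.opNorm_le_bound (by positivity) fun x => (hR x).trans ?_
    rw [mul_assoc]
    exact mul_le_mul_of_nonneg_left ((hgT x).trans (T.le_opNorm x)) ha
  · exact (norm_add_le _ _).trans (add_le_add_right (hR x) _)

/-- Up to an error `e`, all almost norming vectors of `S` are normed by one functional, which is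
dominated by `S`. -/
def AlmostNormedByFunctional {X Y : Type*} [NormedAddCommGroup X] [NormedSpace ℝ X]
    [NormedAddCommGroup Y] [NormedSpace ℝ Y] (e : ℝ) (S : X →L[ℝ] Y) : Prop :=
  ∃ φ : StrongDual ℝ X, (∀ x, ‖x‖ ≤ 1 → |φ x| ≤ ‖S x‖ + e) ∧
    ∃ r > 0, ∀ x, ‖x‖ ≤ 1 → ‖S‖ - r ≤ ‖S x‖ → ‖S‖ - e ≤ |φ x|

lemma dense_interior_almostNormedByFunctional {X Y : Type*} [NormedAddCommGroup X]
    [NormedSpace ℝ X] [NormedAddCommGroup Y] [NormedSpace ℝ Y] {e : ℝ} (he : 0 < e) :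
    Dense (interior {S : X →L[ℝ] Y | AlmostNormedByFunctional e S}) := by
  refine Metric.dense_iff.2 fun T η hη => ?_
  obtain ⟨a, ha, haη, hae⟩ : ∃ a : ℝ, 0 < a ∧ a * ‖T‖ < η ∧ a * ‖T‖ < e / 4 := by
    have hpos : 0 < min η (e / 4) := lt_min hη (by positivity)
    have hlt : min η (e / 4) / (‖T‖ + 1) * ‖T‖ < min η (e / 4) := by
      rw [div_mul_eq_mul_div, div_lt_iff₀ (by positivity)]
      nlinarith [norm_nonneg T]
    exact ⟨min η (e / 4) / (‖T‖ + 1), by positivity,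
      hlt.trans_le (min_le_left _ _), hlt.trans_le (min_le_right _ _)⟩
  obtain ⟨θ, hθ, hθe, hθa⟩ : ∃ θ : ℝ, 0 < θ ∧ θ ≤ e / 4 ∧ 4 * θ ≤ a * (e / 4) :=
    ⟨min (e / 4) (a * (e / 4) / 4), by positivity, min_le_left _ _, by
      linarith [min_le_right (e / 4) (a * (e / 4) / 4)]⟩
  obtain ⟨x₀, hx₀, hTx₀⟩ : ∃ x₀ : X, ‖x₀‖ ≤ 1 ∧ ‖T‖ - θ < ‖T x₀‖ := by
    obtain ⟨x₀, h, h'⟩ := T.exists_lt_apply_of_lt_opNorm (sub_lt_self ‖T‖ hθ)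
    exact ⟨x₀, h.le, h'⟩
  obtain ⟨g, T', hg, -, hlow, hdist, hup⟩ := exists_rankOne_perturbation T hx₀ ha.le
  refine ⟨T', by rw [mem_ball, dist_eq_norm]; exact hdist.trans_lt haη,
    mem_interior.2 ⟨ball T' θ, fun S hS => ?_, isOpen_ball, mem_ball_self hθ⟩⟩
  rw [mem_ball, dist_eq_norm] at hS
  have hTT' : ‖T'‖ ≤ ‖T‖ + a * ‖T‖ := by linarith [norm_le_norm_add_norm_sub' T' T]
  have hSn : |‖S‖ - ‖T'‖| < θ := (abs_norm_sub_norm_le S T').trans_lt hS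
  rw [abs_lt] at hSn
  refine ⟨g.comp T, fun x hx => ?_, θ, hθ, fun x hx hSx => ?_⟩
  · have h1 : |g (T x)| ≤ ‖T x‖ := by simpa using g.le_of_opNorm_le hg (T x)
    have h2 : ‖(S - T') x‖ ≤ ‖S - T'‖ := (S - T').unit_le_opNorm x hx
    have h3 : ‖(T' - T) x‖ ≤ ‖T' - T‖ := (T' - T).unit_le_opNorm x hx
    have h4 : ‖T x‖ ≤ ‖S x‖ + ‖(S - T') x‖ + ‖(T' - T) x‖ := by
      have : T x = S x - (S - T') x - (T' - T) x := by simp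
      calc ‖T x‖ = ‖S x - (S - T') x - (T' - T) x‖ := by rw [← this]
        _ ≤ _ := (norm_sub_le _ _).trans (by gcongr; exact norm_sub_le _ _)
    simp only [ContinuousLinearMap.comp_apply]
    linarith
  · have h2 : ‖(S - T') x‖ ≤ ‖S - T'‖ := (S - T').unit_le_opNorm x hx
    have h3 : ‖S x‖ ≤ ‖T' x‖ + ‖(S - T') x‖ := by
      simpa using norm_add_le (T' x) ((S - T') x)
    have h4 : ‖T x‖ ≤ ‖T‖ := T.unit_le_opNorm x hx
    have h5 := hup x
    simp only [ContinuousLinearMap.comp_apply]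
    have h6 : a * (‖T x₀‖ - e / 4) ≤ a * |g (T x)| := by linarith
    have h7 := le_of_mul_le_mul_left h6 ha
    linarith

/-- Lindenstrauss: on a reflexive space the norm-attaining operators are dense. -/
theorem exists_normAttaining_of_reflexive {X Y : Type*} [NormedAddCommGroup X]
    [NormedSpace ℝ X] [NormedAddCommGroup Y] [NormedSpace ℝ Y] [CompleteSpace Y]
    (hrefl : Function.Surjective ⇑(NormedSpace.inclusionInDoubleDual ℝ X))
    (T : X →L[ℝ] Y) {η : ℝ} (hη : 0 < η) :
    ∃ (S : X →L[ℝ] Y) (x : X), ‖S - T‖ < η ∧ ‖x‖ ≤ 1 ∧ ‖S x‖ = ‖S‖ := by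
  have hd : Dense (⋂ n : ℕ, interior {S : X →L[ℝ] Y |
      AlmostNormedByFunctional (1 / ((n : ℝ) + 1)) S}) :=
    dense_iInter_of_isOpen (fun _ => isOpen_interior)
      fun n => dense_interior_almostNormedByFunctional (by positivity)
  obtain ⟨S, hST, hS⟩ := Metric.dense_iff.1 hd T η hη
  rw [mem_ball, dist_eq_norm] at hST
  rw [Set.mem_iInter] at hS
  have hseq : ∀ k : ℕ, ∃ x : X, ‖x‖ ≤ 1 ∧ ‖S‖ - 1 / ((k : ℝ) + 1) < ‖S x‖ := fun k => by
    obtain ⟨x, h, h'⟩ := S.exists_lt_apply_of_lt_opNorm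
      (sub_lt_self ‖S‖ (by positivity : 0 < 1 / ((k : ℝ) + 1)))
    exact ⟨x, h.le, h'⟩
  choose x hx hSx using hseq
  obtain ⟨z, hz, hlim⟩ := exists_weak_limit_of_reflexive hrefl (hyperfilter ℕ) x hx
  refine ⟨S, z, hST, hz, le_antisymm (S.unit_le_opNorm z hz) ?_⟩
  have hinv : Tendsto (fun n : ℕ => 1 / ((n : ℝ) + 1)) atTop (𝓝 0) :=
    tendsto_one_div_add_atTop_nhds_zero_nat
  have hbound : ∀ n : ℕ, ‖S‖ - 2 * (1 / ((n : ℝ) + 1)) ≤ ‖S z‖ := fun n => by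
    obtain ⟨φ, hφ, r, hr, hφS⟩ := interior_subset (hS n)
    have hle : ‖S‖ - 1 / ((n : ℝ) + 1) ≤ |φ z| := by
      have hev : ∀ᶠ k in atTop, ‖S‖ - 1 / ((n : ℝ) + 1) ≤ |φ (x k)| := by
        filter_upwards [hinv.eventually_lt_const hr] with k hk
        exact hφS _ (hx k) (by linarith [hSx k])
      exact ge_of_tendsto (hlim φ).abs (hev.filter_mono Nat.hyperfilter_le_atTop)
    linarith [hφ z hz]
  have hlim' : Tendsto (fun n : ℕ => ‖S‖ - 2 * (1 / ((n : ℝ) + 1))) atTop (𝓝 ‖S‖) := by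
    simpa using (hinv.const_mul 2).const_sub ‖S‖
  exact le_of_tendsto' hlim' hbound

lemma modulusOfConvexity_le {Y : Type*} [NormedAddCommGroup Y] {ε : ℝ} {x y : Y}
    (hx : ‖x‖ ≤ 1) (hy : ‖y‖ ≤ 1) (hxy : ε ≤ ‖x - y‖) :
    modulusOfConvexity Y ε ≤ 1 - ‖x + y‖ / 2 := by
  refine csInf_le ⟨0, ?_⟩ ⟨x, y, hx, hy, hxy, rfl⟩
  rintro d ⟨u, v, hu, hv, -, rfl⟩
  linarith [norm_add_le u v]

lemma modulusOfConvexity_le_one (Y : Type*) [NormedAddCommGroup Y] (ε : ℝ) :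
    modulusOfConvexity Y ε ≤ 1 := by
  by_cases h : ∃ x y : Y, ‖x‖ ≤ 1 ∧ ‖y‖ ≤ 1 ∧ ε ≤ ‖x - y‖
  · obtain ⟨x, y, hx, hy, hxy⟩ := h
    linarith [modulusOfConvexity_le hx hy hxy, norm_nonneg (x + y)]
  · have : {d : ℝ | ∃ x y : Y, ‖x‖ ≤ 1 ∧ ‖y‖ ≤ 1 ∧ ε ≤ ‖x - y‖ ∧ d = 1 - ‖x + y‖ / 2} = ∅ :=
      Set.eq_empty_iff_forall_notMem.2 fun d ⟨x, y, hx, hy, hxy, _⟩ => h ⟨x, y, hx, hy, hxy⟩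
    rw [modulusOfConvexity, this, Real.sInf_empty]
    exact zero_le_one

/-- Let `0 < ε < 1`, `X` a reflexive real Banach space and `Y` a uniformly convex real
Banach space with modulus of convexity `δ_Y`. If `‖T‖ = 1`, `‖x₁‖ = 1` and
`‖T x₁‖ > 1 - (ε/2⁵)·δ_Y(ε/2)`, then there are `S` with `‖S‖ = 1` and `x₂` with
`‖x₂‖ = 1` such that `‖S x₂‖ = 1`, `‖S - T‖ < ε` and `‖T x₁ - S x₂‖ < ε`. -/
theorem bpb_of_reflexive_uniformConvex
    {X : Type*} [NormedAddCommGroup X] [NormedSpace ℝ X] [CompleteSpace X]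
    {Y : Type*} [NormedAddCommGroup Y] [NormedSpace ℝ Y] [CompleteSpace Y]
    [UniformConvexSpace Y]
    (hrefl : Function.Surjective ⇑(NormedSpace.inclusionInDoubleDual ℝ X))
    {ε : ℝ} (hε0 : 0 < ε) (hε1 : ε < 1)
    (T : X →L[ℝ] Y) (x₁ : X) (hT : ‖T‖ = 1) (hx₁ : ‖x₁‖ = 1)
    (hTx₁ : ‖T x₁‖ > 1 - ε / 2 ^ 5 * modulusOfConvexity Y (ε / 2)) :
    ∃ (S : X →L[ℝ] Y) (x₂ : X),
      ‖S‖ = 1 ∧ ‖x₂‖ = 1 ∧ ‖S x₂‖ = 1 ∧ ‖S - T‖ < ε ∧ ‖T x₁ - S x₂‖ < ε := by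
  set δ := modulusOfConvexity Y (ε / 2) with hδ_def
  have hδ1 : δ ≤ 1 := modulusOfConvexity_le_one Y _
  have hT1 : ∀ x : X, ‖x‖ ≤ 1 → ‖T x‖ ≤ 1 := fun x hx => hT ▸ T.unit_le_opNorm x hx
  have hεδ : 0 < ε * δ := by linarith [hT1 x₁ hx₁.le]
  have hδ0 : 0 < δ := pos_of_mul_pos_right hεδ hε0.le
  have hεδ_le : ε * δ ≤ ε := mul_le_of_le_one_right hε0.le hδ1
  have hεδ_le' : ε * δ ≤ δ := mul_le_of_le_one_left hδ0.le hε1.le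
  obtain ⟨g, T', hg, hgx₁, hlow, hdist, hup⟩ :=
    exists_rankOne_perturbation T hx₁.le (by positivity : 0 ≤ ε / 8)
  obtain ⟨R, z, hRT', hz, hRz⟩ :=
    exists_normAttaining_of_reflexive hrefl T' (by positivity : 0 < ε * δ / 64)
  have hRT : ‖R - T‖ ≤ ε / 8 + ε * δ / 64 := by
    rw [hT] at hdist
    linarith [norm_sub_le_norm_sub_add_norm_sub R T' T]
  have hR1 : |‖R‖ - 1| ≤ ε / 8 + ε * δ / 64 := hT ▸ (abs_norm_sub_norm_le R T).trans hRT
  have hR0 : 0 < ‖R‖ := by linarith [(abs_le.1 hR1).1]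
  have hgz : 1 - δ < |g (T z)| := by
    have h1 : ‖T'‖ - ε * δ / 64 < ‖R‖ := by
      linarith [norm_le_norm_add_norm_sub R T']
    have h2 : ‖R z‖ ≤ ‖T' z‖ + ε * δ / 64 := by
      have h : ‖(R - T') z‖ ≤ ‖R - T'‖ := (R - T').unit_le_opNorm z hz
      have h' : ‖R z‖ ≤ ‖T' z‖ + ‖(R - T') z‖ := by
        simpa using norm_add_le (T' z) ((R - T') z)
      linarith
    have h3 := hup z
    have h4 := hT1 z hz
    have h5 : ε / 8 * (‖T x₁‖ - δ / 2) < ε / 8 * |g (T z)| := by nlinarith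
    have h6 := lt_of_mul_lt_mul_left h5 (by positivity)
    linarith
  obtain ⟨x₂, hx₂, hRx₂, hgx₂⟩ : ∃ x₂ : X, ‖x₂‖ ≤ 1 ∧ ‖R x₂‖ = ‖R‖ ∧ 1 - δ < g (T x₂) := by
    rcases lt_abs.1 hgz with h | h
    · exact ⟨z, hz, hRz, h⟩
    · exact ⟨-z, by simpa using hz, by simpa using hRz, by simpa using h⟩
  have hTT : ‖T x₁ - T x₂‖ < ε / 2 := by
    by_contra! h
    have h1 := modulusOfConvexity_le (hT1 x₁ hx₁.le) (hT1 x₂ hx₂) h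
    have h2 : g (T x₁ + T x₂) ≤ ‖T x₁ + T x₂‖ :=
      (le_abs_self _).trans (by simpa using g.le_of_opNorm_le hg (T x₁ + T x₂))
    rw [map_add] at h2
    linarith
  have hSR : ‖‖R‖⁻¹ • R - R‖ = |‖R‖ - 1| := by
    have h : ‖R‖⁻¹ • R - R = (‖R‖⁻¹ - 1) • R := by rw [sub_smul, one_smul]
    rw [h, norm_smul, Real.norm_eq_abs]
    nth_rewrite 2 [← abs_of_pos hR0]
    rw [← abs_mul, sub_mul, inv_mul_cancel₀ hR0.ne', one_mul, abs_sub_comm]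
  have hST : ‖‖R‖⁻¹ • R - T‖ < ε / 2 := by
    linarith [norm_sub_le_norm_sub_add_norm_sub (‖R‖⁻¹ • R) R T]
  refine ⟨‖R‖⁻¹ • R, x₂, ?_, le_antisymm hx₂ ?_, ?_, by linarith, ?_⟩
  · rw [norm_smul, norm_inv, norm_norm, inv_mul_cancel₀ hR0.ne']
  · have h := R.le_opNorm x₂
    rw [hRx₂] at h
    exact le_of_mul_le_mul_left (by linarith) hR0
  · rw [smul_apply, norm_smul, norm_inv, norm_norm, hRx₂,
      inv_mul_cancel₀ hR0.ne']
  · have h := (‖R‖⁻¹ • R - T).unit_le_opNorm x₂ hx₂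
    rw [sub_apply, norm_sub_rev] at h
    linarith [norm_sub_le_norm_sub_add_norm_sub (T x₁) (T x₂) ((‖R‖⁻¹ • R) x₂)]
end
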